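/- arXiv:2004.12234 — 3 statements merged into one kernel-verified Lean document; each statement's English description precedes it below -/
import Mathlib

section
/- Fix p, q ∈ ℕ and let (Ω, 𝓕, P) be a probability space. Let Z : Ω → ℝ^p, X : Ω → ℝ^q and R : Ω → {0,1} be measurable, let 𝓖 be the σ-algebra generated by (Z, X, R), let α₀ ∈ ℝ^q and λ ≥ 0, and let V : Ω → [0, ∞) be integrable with E[V | 𝓖] = R·exp(⟨α₀, X⟩)·λ almost surely. Fix β ∈ ℝ^p and assume (1 + ‖Z‖)·exp(⟨β, Z⟩ − ⟨α₀, X⟩)·V and R·(1 + ‖Z‖)·exp(⟨β, Z⟩) are integrable. Then: (i) E[exp(⟨β, Z⟩ − ⟨α₀, X⟩)·V] = λ·E[R·exp(⟨β, Z⟩)]; (ii) E[Z·exp(⟨β, Z⟩ − ⟨α₀, X⟩)·V] = λ·E[R·Z·exp(⟨β, Z⟩)]; and (iii) if λ > 0 and E[R·exp(⟨β, Z⟩)] > 0, then E[Z·exp(⟨β, Z⟩ − ⟨α₀, X⟩)·V] / E[exp(⟨β, Z⟩ − ⟨α₀, X⟩)·V] = E[R·Z·exp(⟨β, Z⟩)]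 / E[R·exp(⟨β, Z⟩)]. (This is the inverse-rate-weighting identity, Equation (5) of the paper, showing that under visiting-at-random with Cox-type visit model the weighted covariate moments from non-event visits recover s^{(k)}(t,β)λ₀(t) and hence the covariate mean function ℰ(t,β).) -/
open MeasureTheory Real
open scoped RealInnerProductSpace

theorem irw_aux {E : Type*} [NormedAddCommGroup E] [NormedSpace ℝ E] [CompleteSpace E]
    {Ω : Type*} {m m0 : MeasurableSpace Ω} (hm : m ≤ m0) (P : Measure[m0] Ω)
    [IsProbabilityMeasure P] (V g : Ω → ℝ) (f : Ω → E) (hf : StronglyMeasurable[m] f)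
    (hV : Integrable V P) (hVf : Integrable (V • f) P) (hc : P[V | m] =ᵐ[P] g) :
    ∫ ω, V ω • f ω ∂P = ∫ ω, g ω • f ω ∂P := by
  have h := condExp_smul_of_aestronglyMeasurable_right hV hVf
    (hf.aestronglyMeasurable)
  calc ∫ ω, V ω • f ω ∂P = ∫ ω, (P[V • f | m]) ω ∂P := (integral_condExp hm).symm
    _ = ∫ ω, g ω • f ω ∂P := by
      apply integral_congr_ae
      filter_upwards [h, hc] with ω h1 h2
      rw [h1, Pi.smul_apply', h2]

/-- The inverse-rate-weighting identity (Equation (5) of the paper): under the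
visiting-at-random assumption with a Cox-type non-event visit model, the
inverse-rate-weighted covariate moments from non-event visits recover
`s^{(k)}(t,β)·λ₀(t)` and hence the covariate mean function `ℰ(t,β)`. -/
theorem inverse_rate_weighting_identity
    {p q : ℕ} {Ω : Type*} [MeasurableSpace Ω]
    (P : Measure Ω) [IsProbabilityMeasure P]
    (Z : Ω → EuclideanSpace ℝ (Fin p)) (X : Ω → EuclideanSpace ℝ (Fin q)) (R : Ω → ℝ)
    (hZ : Measurable Z) (hX : Measurable X) (hR : Measurable R)
    (hR01 : ∀ ω, R ω = 0 ∨ R ω = 1)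
    (𝓖 : MeasurableSpace Ω)
    (h𝓖 : 𝓖 = MeasurableSpace.comap (fun ω => (Z ω, X ω, R ω)) inferInstance)
    (α₀ : EuclideanSpace ℝ (Fin q)) (lam : ℝ) (hlam : 0 ≤ lam)
    (V : Ω → ℝ) (hV0 : ∀ ω, 0 ≤ V ω) (hVint : Integrable V P)
    (hcond : P[V | 𝓖] =ᵐ[P] fun ω => R ω * exp ⟪α₀, X ω⟫ * lam)
    (β : EuclideanSpace ℝ (Fin p))
    (hint1 : Integrable (fun ω => (1 + ‖Z ω‖) * exp (⟪β, Z ω⟫ - ⟪α₀, X ω⟫) * V ω) P)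
    (hint2 : Integrable (fun ω => R ω * (1 + ‖Z ω‖) * exp ⟪β, Z ω⟫) P) :
    (∫ ω, exp (⟪β, Z ω⟫ - ⟪α₀, X ω⟫) * V ω ∂P)
        = lam * ∫ ω, R ω * exp ⟪β, Z ω⟫ ∂P ∧
    (∫ ω, (exp (⟪β, Z ω⟫ - ⟪α₀, X ω⟫) * V ω) • Z ω ∂P)
        = lam • ∫ ω, (R ω * exp ⟪β, Z ω⟫) • Z ω ∂P ∧
    (0 < lam → 0 < ∫ ω, R ω * exp ⟪β, Z ω⟫ ∂P →
      (∫ ω, exp (⟪β, Z ω⟫ - ⟪α₀, X ω⟫) * V ω ∂P)⁻¹ •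
          (∫ ω, (exp (⟪β, Z ω⟫ - ⟪α₀, X ω⟫) * V ω) • Z ω ∂P)
        = (∫ ω, R ω * exp ⟪β, Z ω⟫ ∂P)⁻¹ •
          (∫ ω, (R ω * exp ⟪β, Z ω⟫) • Z ω ∂P)) := by
  have hT : Measurable[𝓖] (fun ω => (Z ω, X ω, R ω)) := by
    rw [h𝓖]; exact comap_measurable _
  have hm := (hZ.prodMk (hX.prodMk hR)).comap_le
  rw [← h𝓖] at hm
  have hw0 : Measurable (fun x : EuclideanSpace ℝ (Fin p) × EuclideanSpace ℝ (Fin q) × ℝ =>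
      exp (⟪β, x.1⟫ - ⟪α₀, x.2.1⟫)) := by fun_prop
  have hw1 : Measurable (fun x : EuclideanSpace ℝ (Fin p) × EuclideanSpace ℝ (Fin q) × ℝ =>
      exp (⟪β, x.1⟫ - ⟪α₀, x.2.1⟫) • x.1) := by fun_prop
  have hf0 : StronglyMeasurable[𝓖] (fun ω => exp (⟪β, Z ω⟫ - ⟪α₀, X ω⟫)) :=
    (hw0.comp hT).stronglyMeasurable
  have hf1 : StronglyMeasurable[𝓖] (fun ω => exp (⟪β, Z ω⟫ - ⟪α₀, X ω⟫) • Z ω) :=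
    (hw1.comp hT).stronglyMeasurable
  have hi0 : Integrable (V • (fun ω => exp (⟪β, Z ω⟫ - ⟪α₀, X ω⟫))) P := by
    refine hint1.mono (hVint.1.smul (hf0.mono hm).aestronglyMeasurable) (.of_forall fun ω => ?_)
    simp only [Pi.smul_apply', smul_eq_mul, norm_mul, Real.norm_eq_abs, abs_of_nonneg (hV0 ω),
      abs_of_pos (exp_pos _), abs_of_nonneg (by positivity : 0 ≤ 1 + ‖Z ω‖)]
    have := mul_nonneg (norm_nonneg (Z ω))
      (mul_nonneg (exp_pos (⟪β, Z ω⟫ - ⟪α₀, X ω⟫)).le (hV0 ω))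
    linarith
  have hi1 : Integrable (V • (fun ω => exp (⟪β, Z ω⟫ - ⟪α₀, X ω⟫) • Z ω)) P := by
    refine hint1.mono (hVint.1.smul (hf1.mono hm).aestronglyMeasurable) (.of_forall fun ω => ?_)
    simp only [Pi.smul_apply', norm_smul, norm_mul, Real.norm_eq_abs, abs_of_nonneg (hV0 ω),
      abs_of_pos (exp_pos _), abs_of_nonneg (by positivity : 0 ≤ 1 + ‖Z ω‖)]
    have := mul_nonneg (exp_pos (⟪β, Z ω⟫ - ⟪α₀, X ω⟫)).le (hV0 ω)
    linarith
  have key : ∀ ω, R ω * exp ⟪α₀, X ω⟫ * lam * exp (⟪β, Z ω⟫ - ⟪α₀, X ω⟫)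
      = lam * (R ω * exp ⟪β, Z ω⟫) := by
    intro ω
    rw [exp_sub]
    have := (exp_pos ⟪α₀, X ω⟫).ne'
    field_simp
  have h1 : (∫ ω, exp (⟪β, Z ω⟫ - ⟪α₀, X ω⟫) * V ω ∂P)
        = lam * ∫ ω, R ω * exp ⟪β, Z ω⟫ ∂P := by
    have := irw_aux hm P V _ _ hf0 hVint hi0 hcond
    simp only [smul_eq_mul, key] at this
    rw [integral_const_mul] at this
    rw [← this]
    simp only [mul_comm]
  have h2 : (∫ ω, (exp (⟪β, Z ω⟫ - ⟪α₀, X ω⟫) * V ω) • Z ω ∂P)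
        = lam • ∫ ω, (R ω * exp ⟪β, Z ω⟫) • Z ω ∂P := by
    have := irw_aux hm P V _ _ hf1 hVint hi1 hcond
    simp only [smul_smul, key] at this
    simp only [mul_comm _ (V _), this, ← integral_smul, smul_smul]
  refine ⟨h1, h2, fun hl hp => ?_⟩
  rw [h1, h2, smul_smul]
  congr 1
  field_simp
end

section
/- Fix p ∈ ℕ and let (Ω, 𝓕, P) be a probability space. Let Z : Ω → ℝ^p and R : Ω → {0,1} be measurable and let 𝓗 be the σ-algebra generated by (Z, R). Let β₀, γ₀ ∈ ℝ^p, m ≥ 0 and λ > 0. Let W, V : Ω → [0, ∞) be integrable with E[W | 𝓗] = R·exp(⟨β₀, Z⟩)·m and E[V | 𝓗] = R·exp(⟨γ₀, Z⟩)·λ almost surely. Assume (1 + ‖Z‖)·W, (1 + ‖Z‖)·exp(⟨β₀ − γ₀, Z⟩)·V and R·(1 + ‖Z‖)·exp(⟨β₀, Z⟩) are integrable and E[R·exp(⟨β₀, Z⟩)] > 0. Then, setting β = β₀ − γ₀, E[Z·W] − (E[Z·exp(⟨β, Z⟩)·V] / E[exp(⟨β, Z⟩)·V])·E[W] = 0.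 (This is the pointwise-in-time statement that the naive limiting score 𝒰₀(β + γ₀) vanishes at β = β₀ − γ₀: under informative non-event visits with visit rate exp(γ₀ᵀZ)λ₀, the estimator obtained by solving the unweighted kernel-smoothed estimating equation U₃(β) = 0 converges in probability to β₀ − γ₀, so it is biased by −γ₀ whenever γ₀ ≠ 0.) -/
open MeasureTheory Real
open scoped RealInnerProductSpace

lemma key_pullout {Ω E : Type*} [NormedAddCommGroup E] [NormedSpace ℝ E] [CompleteSpace E]
    {m m0 : MeasurableSpace Ω} (P : Measure Ω) [IsProbabilityMeasure P] (hm : m ≤ m0)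
    {X g : Ω → ℝ} {f : Ω → E} (hf : StronglyMeasurable[m] f) (hX : Integrable X P)
    (hXf : Integrable (fun ω => X ω • f ω) P) (hg : P[X | m] =ᵐ[P] g) :
    ∫ ω, X ω • f ω ∂P = ∫ ω, g ω • f ω ∂P := by
  have h := condExp_bilin_of_stronglyMeasurable_right (μ := P) (ContinuousLinearMap.lsmul ℝ ℝ)
    hf hXf hX
  rw [← integral_condExp hm]
  apply integral_congr_ae
  filter_upwards [h, hg] with ω h1 h2
  simp only [ContinuousLinearMap.lsmul_apply] at h1
  rw [h1, h2]

/-- Pointwise-in-time statement that the naive limiting score `𝒰₀(β + γ₀)`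
vanishes at `β = β₀ − γ₀`: under informative non-event visits with visit rate
`exp(γ₀ᵀZ)λ₀`, the unweighted kernel-smoothed estimating equation converges to
`β₀ − γ₀`, i.e. it is biased by `−γ₀` whenever `γ₀ ≠ 0`. -/
theorem naive_score_vanishes_at_biased_parameter
    {p : ℕ} {Ω : Type*} [MeasurableSpace Ω]
    (P : Measure Ω) [IsProbabilityMeasure P]
    (Z : Ω → EuclideanSpace ℝ (Fin p)) (R : Ω → ℝ)
    (hZ : Measurable Z) (hR : Measurable R)
    (hR01 : ∀ ω, R ω = 0 ∨ R ω = 1)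
    (𝓗 : MeasurableSpace Ω)
    (h𝓗 : 𝓗 = MeasurableSpace.comap (fun ω => (Z ω, R ω)) inferInstance)
    (β₀ γ₀ : EuclideanSpace ℝ (Fin p)) (m lam : ℝ) (hm : 0 ≤ m) (hlam : 0 < lam)
    (W V : Ω → ℝ) (hW0 : ∀ ω, 0 ≤ W ω) (hV0 : ∀ ω, 0 ≤ V ω)
    (hWint : Integrable W P) (hVint : Integrable V P)
    (hcondW : P[W | 𝓗] =ᵐ[P] fun ω => R ω * exp ⟪β₀, Z ω⟫ * m)
    (hcondV : P[V | 𝓗] =ᵐ[P] fun ω => R ω * exp ⟪γ₀, Z ω⟫ * lam)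
    (hint1 : Integrable (fun ω => (1 + ‖Z ω‖) * W ω) P)
    (hint2 : Integrable (fun ω => (1 + ‖Z ω‖) * exp ⟪β₀ - γ₀, Z ω⟫ * V ω) P)
    (hint3 : Integrable (fun ω => R ω * (1 + ‖Z ω‖) * exp ⟪β₀, Z ω⟫) P)
    (hpos : 0 < ∫ ω, R ω * exp ⟪β₀, Z ω⟫ ∂P) :
    (∫ ω, W ω • Z ω ∂P) -
      (∫ ω, W ω ∂P) •
        ((∫ ω, exp ⟪β₀ - γ₀, Z ω⟫ * V ω ∂P)⁻¹ •
          (∫ ω, (exp ⟪β₀ - γ₀, Z ω⟫ * V ω) • Z ω ∂P)) = 0 := by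
  rename_i mΩ hPP
  have hle : 𝓗 ≤ mΩ := by
    rw [h𝓗]; exact (hZ.prodMk hR).comap_le
  have hZm : Measurable[𝓗] Z := by
    rw [h𝓗]
    exact measurable_fst.comp (comap_measurable (fun ω => (Z ω, R ω)))
  have hem : Measurable[𝓗] (fun ω => exp ⟪β₀ - γ₀, Z ω⟫) := by
    have : Measurable (fun z : EuclideanSpace ℝ (Fin p) => exp ⟪β₀ - γ₀, z⟫) := by fun_prop
    exact this.comp hZm
  have hem0 := hem.mono hle le_rfl
  have hexp : ∀ ω, exp ⟪γ₀, Z ω⟫ * exp ⟪β₀ - γ₀, Z ω⟫ = exp ⟪β₀, Z ω⟫ := by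
    intro ω
    rw [← Real.exp_add, ← inner_add_left]; simp
  have iWZ : Integrable (fun ω => W ω • Z ω) P := by
    refine hint1.mono (hWint.1.smul hZ.aestronglyMeasurable) (ae_of_all _ fun ω => ?_)
    have h1 := hW0 ω
    have h2 := norm_nonneg (Z ω)
    rw [norm_smul, Real.norm_of_nonneg h1, Real.norm_of_nonneg (by positivity)]
    nlinarith
  have iV : Integrable (fun ω => V ω • exp ⟪β₀ - γ₀, Z ω⟫) P := by
    refine hint2.mono (hVint.1.smul hem0.aestronglyMeasurable) (ae_of_all _ fun ω => ?_)
    have h1 := hV0 ω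
    have h2 := norm_nonneg (Z ω)
    have h3 := Real.exp_pos ⟪β₀ - γ₀, Z ω⟫
    rw [norm_smul, Real.norm_of_nonneg h1, Real.norm_of_nonneg h3.le,
      Real.norm_of_nonneg (by positivity)]
    nlinarith [mul_nonneg h2 (mul_nonneg h3.le h1)]
  have iVZ : Integrable (fun ω => V ω • (exp ⟪β₀ - γ₀, Z ω⟫ • Z ω)) P := by
    refine hint2.mono (hVint.1.smul (hem0.smul hZ).aestronglyMeasurable)
      (ae_of_all _ fun ω => ?_)
    have h1 := hV0 ω
    have h2 := norm_nonneg (Z ω)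
    have h3 := Real.exp_pos ⟪β₀ - γ₀, Z ω⟫
    rw [norm_smul, norm_smul, Real.norm_of_nonneg h1, Real.norm_of_nonneg h3.le,
      Real.norm_of_nonneg (by positivity)]
    nlinarith [mul_nonneg h3.le h1]
  have e1 : ∫ ω, W ω • Z ω ∂P = m • ∫ ω, (R ω * exp ⟪β₀, Z ω⟫) • Z ω ∂P := by
    rw [key_pullout P hle hZm.stronglyMeasurable hWint iWZ hcondW, ← integral_smul]
    congr 1; ext1 ω
    rw [smul_smul]; congr 1; ring
  have e2 : ∫ ω, W ω ∂P = m * ∫ ω, R ω * exp ⟪β₀, Z ω⟫ ∂P := by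
    rw [← integral_condExp hle, integral_congr_ae hcondW, ← integral_const_mul]
    congr 1; ext1 ω; ring
  have e3 : ∫ ω, exp ⟪β₀ - γ₀, Z ω⟫ * V ω ∂P = lam * ∫ ω, R ω * exp ⟪β₀, Z ω⟫ ∂P := by
    have := key_pullout P hle hem.stronglyMeasurable hVint iV hcondV
    simp only [smul_eq_mul] at this
    simp_rw [mul_comm _ (V _)]
    rw [this, ← integral_const_mul]
    congr 1; ext1 ω
    rw [← hexp]; ring
  have e4 : ∫ ω, (exp ⟪β₀ - γ₀, Z ω⟫ * V ω) • Z ω ∂P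
      = lam • ∫ ω, (R ω * exp ⟪β₀, Z ω⟫) • Z ω ∂P := by
    have := key_pullout P hle (hem.smul hZm).stronglyMeasurable hVint iVZ hcondV
    simp only [smul_smul, Pi.smul_apply'] at this
    simp_rw [mul_comm _ (V _)]
    rw [this, ← integral_smul]
    congr 1; ext1 ω
    rw [← hexp, smul_smul]; congr 1; ring
  rw [e1, e2, e3, e4, smul_smul, smul_smul, sub_eq_zero]
  congr 1
  have := hpos.ne'
  have := hlam.ne'
  field_simp
end

section
/- Fix p, q ∈ ℕ and let (Ω, 𝓕, P) be a probability space. Let Z : Ω → ℝ^p, W : Ω → ℝ^q and R : Ω → {0,1} be measurable and let 𝓖 be the σ-algebra generated by (Z, W, R). Let β₀ ∈ ℝ^p, θ₀ ∈ ℝ^q, m > 0 and ℓ > 0. Let V_N, V_O : Ω → [0, ∞) be integrable with E[V_N | 𝓖] = R·exp(⟨β₀, Z⟩)·m and E[V_O | 𝓖] = R·exp(⟨θ₀, W⟩)·ℓ almost surely. Assume (1+‖Z‖)·V_N, (1+‖W‖)·V_O, (1+‖Z‖)·exp(⟨β₀,Z⟩ − ⟨θ₀,W⟩)·V_O, (1+‖W‖)·exp(⟨θ₀,W⟩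 − ⟨β₀,Z⟩)·V_N, R·(1+‖Z‖)·exp(⟨β₀,Z⟩) and R·(1+‖W‖)·exp(⟨θ₀,W⟩) are integrable, and E[R·exp(⟨β₀,Z⟩)] > 0 and E[R·exp(⟨θ₀,W⟩)] > 0. Then both of the following hold: (i) E[Z·V_N] − (E[Z·exp(⟨β₀,Z⟩ − ⟨θ₀,W⟩)·V_O] / E[exp(⟨β₀,Z⟩ − ⟨θ₀,W⟩)·V_O])·E[V_N] = 0; and (ii) E[W·V_O] − (E[W·exp(⟨θ₀,W⟩ − ⟨β₀,Z⟩)·V_N] / E[exp(⟨θ₀,W⟩ − ⟨β₀,Z⟩)·V_N])·E[V_O] = 0. (This is the pointwise-in-time statement that the limiting functions 𝒰₄ and 𝒰₅ of the paired estimating equations U₄(β,θ) = 0 and U₅(β,θ) = 0 both vanish at the true parameters (β₀, θ₀), so solving the just-identified system yields a consistent estimate of (β₀, θ₀) when the event and non-event visit processes depend on disjoint covariate sets.) -/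
open MeasureTheory Real
open scoped RealInnerProductSpace

lemma pull_aux {Ω : Type*} {E : Type*} [NormedAddCommGroup E] [NormedSpace ℝ E] [CompleteSpace E]
    {𝓖 mΩ : MeasurableSpace Ω} (P : Measure Ω) [IsProbabilityMeasure P] (hle : 𝓖 ≤ mΩ)
    (f : Ω → E) (g h : Ω → ℝ) (hf : StronglyMeasurable[𝓖] f) (hg : Integrable g P)
    (hfg : Integrable (fun ω => g ω • f ω) P) (hc : P[g | 𝓖] =ᵐ[P] h) :
    ∫ ω, g ω • f ω ∂P = ∫ ω, h ω • f ω ∂P := by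
  rw [← integral_condExp hle]
  apply integral_congr_ae
  have := condExp_smul_of_aestronglyMeasurable_right (m := 𝓖) (μ := P) (f := g) (g := f)
    hg hfg hf.aestronglyMeasurable
  filter_upwards [this, hc] with ω h1 h2
  have h1' : (P[fun ω => g ω • f ω | 𝓖]) ω = (P[g | 𝓖]) ω • f ω := h1
  rw [h1', h2]

lemma half_aux {Ω : Type*} {E : Type*} [NormedAddCommGroup E] [NormedSpace ℝ E] [CompleteSpace E]
    {𝓖 mΩ : MeasurableSpace Ω} (P : Measure Ω) [IsProbabilityMeasure P] (hle : 𝓖 ≤ mΩ)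
    (Z : Ω → E) (a b R : Ω → ℝ) (hZ : StronglyMeasurable[𝓖] Z) (ha : StronglyMeasurable[𝓖] a)
    (hb : StronglyMeasurable[𝓖] b) (m l : ℝ) (hm : 0 < m) (hl : 0 < l) (N O : Ω → ℝ)
    (hN0 : ∀ ω, 0 ≤ N ω) (hO0 : ∀ ω, 0 ≤ O ω) (hN : Integrable N P) (hO : Integrable O P)
    (hcN : P[N | 𝓖] =ᵐ[P] fun ω => R ω * exp (a ω) * m)
    (hcO : P[O | 𝓖] =ᵐ[P] fun ω => R ω * exp (b ω) * l)
    (h1 : Integrable (fun ω => (1 + ‖Z ω‖) * N ω) P)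
    (h3 : Integrable (fun ω => (1 + ‖Z ω‖) * exp (a ω - b ω) * O ω) P)
    (hpos : 0 < ∫ ω, R ω * exp (a ω) ∂P) :
    (∫ ω, N ω • Z ω ∂P) - (∫ ω, N ω ∂P) •
          ((∫ ω, exp (a ω - b ω) * O ω ∂P)⁻¹ •
            (∫ ω, (exp (a ω - b ω) * O ω) • Z ω ∂P)) = 0 := by
  have hE : StronglyMeasurable[𝓖] (fun ω => exp (a ω - b ω)) :=
    Real.continuous_exp.comp_stronglyMeasurable (ha.sub hb)
  have hEm : AEStronglyMeasurable (fun ω => exp (a ω - b ω)) P := (hE.mono hle).aestronglyMeasurable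
  have hZm : AEStronglyMeasurable Z P := (hZ.mono hle).aestronglyMeasurable
  have e1 : ∫ ω, N ω • Z ω ∂P = m • ∫ ω, (R ω * exp (a ω)) • Z ω ∂P := by
    rw [pull_aux P hle Z N _ hZ hN _ hcN, ← integral_smul]
    · congr 1; ext ω; rw [smul_smul]; congr 1; ring
    · refine h1.mono (hN.1.smul hZm) (.of_forall fun ω => ?_)
      have := hN0 ω
      rw [norm_smul, Real.norm_of_nonneg this, Real.norm_of_nonneg (by positivity)]
      nlinarith [norm_nonneg (Z ω)]
  have e2 : ∫ ω, N ω ∂P = m * ∫ ω, R ω * exp (a ω) ∂P := by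
    rw [← integral_condExp hle, integral_congr_ae hcN, integral_mul_const, mul_comm]
  have key : ∀ ω, exp (b ω) * exp (a ω - b ω) = exp (a ω) := fun ω => by
    rw [← Real.exp_add]; congr 1; ring
  have e3 : ∫ ω, exp (a ω - b ω) * O ω ∂P = l * ∫ ω, R ω * exp (a ω) ∂P := by
    have := pull_aux P hle (fun ω => exp (a ω - b ω)) O _ hE hO ?_ hcO
    · simp only [smul_eq_mul] at this
      rw [← integral_const_mul]
      refine Eq.trans ?_ (this.trans ?_)
      · exact integral_congr_ae (.of_forall fun ω => by simp only []; ring)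
      · exact integral_congr_ae (.of_forall fun ω => by simp only []; rw [← key ω]; ring)
    · refine h3.mono (hO.1.smul hEm) (.of_forall fun ω => ?_)
      have := hO0 ω
      rw [norm_smul, Real.norm_of_nonneg this, Real.norm_of_nonneg (by positivity),
        Real.norm_of_nonneg (by positivity)]
      have : 0 ≤ ‖Z ω‖ * (exp (a ω - b ω) * O ω) := by positivity
      nlinarith
  have e4 : ∫ ω, (exp (a ω - b ω) * O ω) • Z ω ∂P = l • ∫ ω, (R ω * exp (a ω)) • Z ω ∂P := by
    have := pull_aux P hle (fun ω => exp (a ω - b ω) • Z ω) O _ (hE.smul hZ) hO ?_ hcO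
    · rw [← integral_smul]
      convert this using 2
      · ext ω; rw [smul_smul, mul_comm]
      · ext ω; rw [smul_smul, smul_smul, ← key ω]; congr 1; ring
    · refine h3.mono (hO.1.smul (hEm.smul hZm)) (.of_forall fun ω => ?_)
      have := hO0 ω
      rw [norm_smul, norm_smul, Real.norm_of_nonneg this, Real.norm_of_nonneg (by positivity),
        Real.norm_of_nonneg (by positivity)]
      have : 0 ≤ (exp (a ω - b ω) * O ω) := by positivity
      nlinarith
  rw [e1, e2, e3, e4, smul_smul, smul_smul, sub_eq_zero]
  congr 1
  field_simp

/-- Pointwise-in-time statement that the limiting functions `𝒰₄` and `𝒰₅` of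
the paired estimating equations `U₄(β,θ) = 0` and `U₅(β,θ) = 0` both vanish at
the true parameters `(β₀, θ₀)`, when the event and non-event visit processes
depend on disjoint covariate sets. -/
theorem paired_limiting_scores_vanish
    {p q : ℕ} {Ω : Type*} [MeasurableSpace Ω]
    (P : Measure Ω) [IsProbabilityMeasure P]
    (Z : Ω → EuclideanSpace ℝ (Fin p)) (W : Ω → EuclideanSpace ℝ (Fin q)) (R : Ω → ℝ)
    (hZ : Measurable Z) (hW : Measurable W) (hR : Measurable R)
    (hR01 : ∀ ω, R ω = 0 ∨ R ω = 1)
    (𝓖 : MeasurableSpace Ω)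
    (h𝓖 : 𝓖 = MeasurableSpace.comap (fun ω => (Z ω, W ω, R ω)) inferInstance)
    (β₀ : EuclideanSpace ℝ (Fin p)) (θ₀ : EuclideanSpace ℝ (Fin q))
    (m ℓ : ℝ) (hm : 0 < m) (hℓ : 0 < ℓ)
    (V_N V_O : Ω → ℝ) (hVN0 : ∀ ω, 0 ≤ V_N ω) (hVO0 : ∀ ω, 0 ≤ V_O ω)
    (hVNint : Integrable V_N P) (hVOint : Integrable V_O P)
    (hcondN : P[V_N | 𝓖] =ᵐ[P] fun ω => R ω * exp ⟪β₀, Z ω⟫ * m)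
    (hcondO : P[V_O | 𝓖] =ᵐ[P] fun ω => R ω * exp ⟪θ₀, W ω⟫ * ℓ)
    (hint1 : Integrable (fun ω => (1 + ‖Z ω‖) * V_N ω) P)
    (hint2 : Integrable (fun ω => (1 + ‖W ω‖) * V_O ω) P)
    (hint3 : Integrable (fun ω => (1 + ‖Z ω‖) * exp (⟪β₀, Z ω⟫ - ⟪θ₀, W ω⟫) * V_O ω) P)
    (hint4 : Integrable (fun ω => (1 + ‖W ω‖) * exp (⟪θ₀, W ω⟫ - ⟪β₀, Z ω⟫) * V_N ω) P)
    (hint5 : Integrable (fun ω => R ω * (1 + ‖Z ω‖) * exp ⟪β₀, Z ω⟫) P)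
    (hint6 : Integrable (fun ω => R ω * (1 + ‖W ω‖) * exp ⟪θ₀, W ω⟫) P)
    (hposZ : 0 < ∫ ω, R ω * exp ⟪β₀, Z ω⟫ ∂P)
    (hposW : 0 < ∫ ω, R ω * exp ⟪θ₀, W ω⟫ ∂P) :
    ((∫ ω, V_N ω • Z ω ∂P) -
        (∫ ω, V_N ω ∂P) •
          ((∫ ω, exp (⟪β₀, Z ω⟫ - ⟪θ₀, W ω⟫) * V_O ω ∂P)⁻¹ •
            (∫ ω, (exp (⟪β₀, Z ω⟫ - ⟪θ₀, W ω⟫) * V_O ω) • Z ω ∂P)) = 0) ∧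
    ((∫ ω, V_O ω • W ω ∂P) -
        (∫ ω, V_O ω ∂P) •
          ((∫ ω, exp (⟪θ₀, W ω⟫ - ⟪β₀, Z ω⟫) * V_N ω ∂P)⁻¹ •
            (∫ ω, (exp (⟪θ₀, W ω⟫ - ⟪β₀, Z ω⟫) * V_N ω) • W ω ∂P)) = 0) := by
  have hle := (hZ.prodMk (hW.prodMk hR)).comap_le
  have hT : Measurable[MeasurableSpace.comap (fun ω => (Z ω, W ω, R ω)) inferInstance]
    (fun ω => (Z ω, W ω, R ω)) := comap_measurable _
  rw [← h𝓖] at hle hT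
  have hZ' : StronglyMeasurable[𝓖] Z := (measurable_fst.comp hT).stronglyMeasurable
  have hW' : StronglyMeasurable[𝓖] W :=
    ((measurable_fst.comp measurable_snd).comp hT).stronglyMeasurable
  have ha : StronglyMeasurable[𝓖] (fun ω => ⟪β₀, Z ω⟫) :=
    (continuous_const.inner continuous_id).comp_stronglyMeasurable hZ'
  have hb : StronglyMeasurable[𝓖] (fun ω => ⟪θ₀, W ω⟫) :=
    (continuous_const.inner continuous_id).comp_stronglyMeasurable hW'
  exact ⟨half_aux P hle Z _ _ R hZ' ha hb m ℓ hm hℓ V_N V_O hVN0 hVO0 hVNint hVOint hcondN hcondO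
      hint1 hint3 hposZ,
    half_aux P hle W _ _ R hW' hb ha ℓ m hℓ hm V_O V_N hVO0 hVN0 hVOint hVNint hcondO hcondN
      hint2 hint4 hposW⟩
end
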